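/- (Completeness) Let K=⟨T,A⟩ be a satisfiable normalised ELHO knowledge base, q=∃y.ψ(x,y) a conjunctive query, and π a candidate answer mapping x to named individuals. If Ξ(K)⊨π(q), then a substitution τ exists with domain x∪y such that τ restricted to x equals π, dat(K)⊨τ(q), and isSpurious(q,dat(K),τ)=false; specifically, τ=δ∘π* works for any π* witnessing Ξ(K)⊨π(q). -/

import Mathlib

namespace ELHO

variable {C R V Ind : Type}

/-- Unary predicates: atomic concepts, ⊤ and ⊥. -/
inductive UPred (C : Type) where
  | conc : C → UPred C
  | top : UPred C
  | bot : UPred C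

/-- Concepts that are either atomic (`some A`) or ⊤ (`none`). -/
abbrev CT (C : Type) := Option C

/-- View a concept-or-⊤ as a unary predicate. -/
def ctU : CT C → UPred C
  | some A => .conc A
  | none => .top

def UPred.clist : UPred C → List C
  | .conc A => [A]
  | _ => []

/-- Normalised ELHO TBox axioms (Table 1). -/
inductive Ax (C R Ind : Type) where
  | nom : Ind → CT C → Ax C R Ind              -- {a} ⊑ A
  | sub : CT C → UPred C → Ax C R Ind          -- A ⊑ B
  | subNom : CT C → Ind → Ax C R Ind           -- A ⊑ {a}
  | conj : CT C → CT C → CT C → Ax C R Ind     -- A1 ⊓ A2 ⊑ A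
  | exSub : R → CT C → CT C → Ax C R Ind       -- ∃R.A1 ⊑ A
  | subEx : CT C → R → CT C → Ax C R Ind       -- A1 ⊑ ∃R.A
  | roleSub : R → R → Ax C R Ind               -- R ⊑ S
  | range : R → CT C → Ax C R Ind              -- ran(R) ⊑ A

/-- Atomic concepts occurring in an axiom. -/
def Ax.concepts : Ax C R Ind → List C
  | .nom _ A => A.toList
  | .sub A B => A.toList ++ B.clist
  | .subNom A _ => A.toList
  | .conj A1 A2 A => A1.toList ++ A2.toList ++ A.toList
  | .exSub _ A1 A => A1.toList ++ A.toList
  | .subEx A1 _ A => A1.toList ++ A.toList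
  | .roleSub _ _ => []
  | .range _ A => A.toList

/-- Roles occurring in an axiom. -/
def Ax.roles : Ax C R Ind → List R
  | .nom _ _ => []
  | .sub _ _ => []
  | .subNom _ _ => []
  | .conj _ _ _ => []
  | .exSub S _ _ => [S]
  | .subEx _ S _ => [S]
  | .roleSub S S' => [S, S']
  | .range S _ => [S]

/-- ABox assertions: ground facts over individuals. -/
inductive AFact (C R Ind : Type) where
  | unary : UPred C → Ind → AFact C R Ind
  | role : R → Ind → Ind → AFact C R Ind

/-- A normalised ELHO knowledge base K = ⟨T,A⟩. -/
structure KB (C R Ind : Type) where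
  tbox : List (Ax C R Ind)
  abox : List (AFact C R Ind)

/-- Terms of the Herbrand universe of Ξ(K): individuals and terms built with
    the unary function symbols `f_{R,A}`. -/
inductive XTerm (C R Ind : Type) where
  | ind : Ind → XTerm C R Ind
  | fn : R → CT C → XTerm C R Ind → XTerm C R Ind

/-- Terms of the Herbrand universe of dat(K): individuals and the auxiliary
    individuals `o_{R,A}`. -/
inductive DTerm (C R Ind : Type) where
  | ind : Ind → DTerm C R Ind
  | aux : R → CT C → DTerm C R Ind

/-- The mapping δ: δ(a) = a and δ(f_{R,A}(w')) = o_{R,A}. -/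
def δ : XTerm C R Ind → DTerm C R Ind
  | .ind a => .ind a
  | .fn S A _ => .aux S A

/-- Ground facts over a term type `T`. -/
inductive Fact (C R T : Type) where
  | unary : UPred C → T → Fact C R T
  | role : R → T → T → Fact C R T
  | eq : T → T → Fact C R T

/-- `t` occurs in the fact (any predicate, including ≈). -/
def occursF {T : Type} (t : T) : Fact C R T → Prop
  | .unary _ s => s = t
  | .role _ s s' => s = t ∨ s' = t
  | .eq s s' => s = t ∨ s' = t

/-- `t` occurs in the fact and the fact is not an ≈-fact. -/
def occursNE {T : Type} (t : T) : Fact C R T → Prop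
  | .unary _ s => s = t
  | .role _ s s' => s = t ∨ s' = t
  | .eq _ _ => False

/-- N_I(H): terms occurring in the model `H` in at least one non-≈ fact. -/
def NI {T : Type} (H : Fact C R T → Prop) (t : T) : Prop := ∃ f, H f ∧ occursNE t f

/-- `t` occurs in the model `H` (in any fact). -/
def occursM {T : Type} (H : Fact C R T → Prop) (t : T) : Prop := ∃ f, H f ∧ occursF t f

/-- aux(H): 'true' auxiliary terms of a Herbrand model `H`, i.e. the terms of
    N_I(H) that are ≈-equal to no named individual (`ι` injects the named
    individuals into the term type). -/
def auxT {T : Type} (H : Fact C R T → Prop) (ι : Ind → T) (t : T) : Prop :=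
  NI H t ∧ ∀ a : Ind, ¬ H (.eq t (ι a))

/-- The minimal Herbrand model of Ξ(K) (with the equality axiomatisation),
    defined as the least set of ground facts closed under all clauses of
    Ξ(K) ∪ Ξ(K)_≈. -/
inductive XI (K : KB C R Ind) : Fact C R (XTerm C R Ind) → Prop where
  | abU {B a} : AFact.unary B a ∈ K.abox → XI K (.unary B (.ind a))
  | abR {S a b} : AFact.role S a b ∈ K.abox → XI K (.role S (.ind a) (.ind b))
  | nom {a A} : Ax.nom a A ∈ K.tbox → XI K (.unary (ctU A) (.ind a))
  | sub {A B w} : Ax.sub A B ∈ K.tbox → XI K (.unary (ctU A) w) → XI K (.unary B w)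
  | subNom {A a w} : Ax.subNom A a ∈ K.tbox → XI K (.unary (ctU A) w) →
      XI K (.eq w (.ind a))
  | conj {A1 A2 A w} : Ax.conj A1 A2 A ∈ K.tbox → XI K (.unary (ctU A1) w) →
      XI K (.unary (ctU A2) w) → XI K (.unary (ctU A) w)
  | exSub {S A1 A w w'} : Ax.exSub S A1 A ∈ K.tbox → XI K (.role S w w') →
      XI K (.unary (ctU A1) w') → XI K (.unary (ctU A) w)
  | subEx1 {A1 S A w} : Ax.subEx A1 S A ∈ K.tbox → XI K (.unary (ctU A1) w) →
      XI K (.role S w (.fn S A w))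
  | subEx2 {A1 S A w} : Ax.subEx A1 S A ∈ K.tbox → XI K (.unary (ctU A1) w) →
      XI K (.unary (ctU A) (.fn S A w))
  | roleSub {S S' w w'} : Ax.roleSub S S' ∈ K.tbox → XI K (.role S w w') →
      XI K (.role S' w w')
  | range {S A w w'} : Ax.range S A ∈ K.tbox → XI K (.role S w w') →
      XI K (.unary (ctU A) w')
  | topU {A w} : A ∈ K.tbox.flatMap Ax.concepts → XI K (.unary (.conc A) w) →
      XI K (.unary .top w)
  | topR1 {S w w'} : S ∈ K.tbox.flatMap Ax.roles → XI K (.role S w w') →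
      XI K (.unary .top w)
  | topR2 {S w w'} : S ∈ K.tbox.flatMap Ax.roles → XI K (.role S w w') →
      XI K (.unary .top w')
  | refl {w f} : XI K f → occursF w f → XI K (.eq w w)
  | symm {w w'} : XI K (.eq w w') → XI K (.eq w' w)
  | trans {w1 w2 w3} : XI K (.eq w1 w2) → XI K (.eq w2 w3) → XI K (.eq w1 w3)
  | repU {B w w'} : XI K (.unary B w) → XI K (.eq w w') → XI K (.unary B w')
  | repR1 {S w1 w2 w'} : XI K (.role S w1 w2) → XI K (.eq w1 w') → XI K (.role S w' w2)
  | repR2 {S w1 w2 w'} : XI K (.role S w1 w2) → XI K (.eq w2 w') → XI K (.role S w1 w')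
  | repF {S A w w'} : XI K (.eq w w') → XI K (.eq (XTerm.fn S A w) (XTerm.fn S A w'))

/-- The minimal Herbrand model of dat(K) (with the equality axiomatisation). -/
inductive DM (K : KB C R Ind) : Fact C R (DTerm C R Ind) → Prop where
  | abU {B a} : AFact.unary B a ∈ K.abox → DM K (.unary B (.ind a))
  | abR {S a b} : AFact.role S a b ∈ K.abox → DM K (.role S (.ind a) (.ind b))
  | nom {a A} : Ax.nom a A ∈ K.tbox → DM K (.unary (ctU A) (.ind a))
  | sub {A B w} : Ax.sub A B ∈ K.tbox → DM K (.unary (ctU A) w) → DM K (.unary B w)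
  | subNom {A a w} : Ax.subNom A a ∈ K.tbox → DM K (.unary (ctU A) w) →
      DM K (.eq w (.ind a))
  | conj {A1 A2 A w} : Ax.conj A1 A2 A ∈ K.tbox → DM K (.unary (ctU A1) w) →
      DM K (.unary (ctU A2) w) → DM K (.unary (ctU A) w)
  | exSub {S A1 A w w'} : Ax.exSub S A1 A ∈ K.tbox → DM K (.role S w w') →
      DM K (.unary (ctU A1) w') → DM K (.unary (ctU A) w)
  | subEx1 {A1 S A w} : Ax.subEx A1 S A ∈ K.tbox → DM K (.unary (ctU A1) w) →
      DM K (.role S w (.aux S A))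
  | subEx2 {A1 S A w} : Ax.subEx A1 S A ∈ K.tbox → DM K (.unary (ctU A1) w) →
      DM K (.unary (ctU A) (.aux S A))
  | roleSub {S S' w w'} : Ax.roleSub S S' ∈ K.tbox → DM K (.role S w w') →
      DM K (.role S' w w')
  | range {S A w w'} : Ax.range S A ∈ K.tbox → DM K (.role S w w') →
      DM K (.unary (ctU A) w')
  | topU {A w} : A ∈ K.tbox.flatMap Ax.concepts → DM K (.unary (.conc A) w) →
      DM K (.unary .top w)
  | topR1 {S w w'} : S ∈ K.tbox.flatMap Ax.roles → DM K (.role S w w') →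
      DM K (.unary .top w)
  | topR2 {S w w'} : S ∈ K.tbox.flatMap Ax.roles → DM K (.role S w w') →
      DM K (.unary .top w')
  | refl {w f} : DM K f → occursF w f → DM K (.eq w w)
  | symm {w w'} : DM K (.eq w w') → DM K (.eq w' w)
  | trans {w1 w2 w3} : DM K (.eq w1 w2) → DM K (.eq w2 w3) → DM K (.eq w1 w3)
  | repU {B w w'} : DM K (.unary B w) → DM K (.eq w w') → DM K (.unary B w')
  | repR1 {S w1 w2 w'} : DM K (.role S w1 w2) → DM K (.eq w1 w') → DM K (.role S w' w2)
  | repR2 {S w1 w2 w'} : DM K (.role S w1 w2) → DM K (.eq w2 w') → DM K (.role S w1 w')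

/-- Terms of a conjunctive query: variables and individuals (constants). -/
inductive QTerm (V Ind : Type) where
  | var : V → QTerm V Ind
  | const : Ind → QTerm V Ind

/-- Function-free atoms of a conjunctive query. -/
inductive QAtom (C R V Ind : Type) where
  | unary : UPred C → QTerm V Ind → QAtom C R V Ind
  | role : R → QTerm V Ind → QTerm V Ind → QAtom C R V Ind

/-- A conjunctive query q = ∃y.ψ(x,y): a set of atoms together with the
    predicate selecting the answer variables x. -/
structure CQ (C R V Ind : Type) where
  answers : V → Prop
  atoms : List (QAtom C R V Ind)

/-- Extension of a substitution on variables to query terms. -/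
def QTerm.evalT {T : Type} (ι : Ind → T) (σ : V → T) : QTerm V Ind → T
  | .var v => σ v
  | .const a => ι a

/-- Application of a substitution to a query atom. -/
def QAtom.applyA {T : Type} (ι : Ind → T) (σ : V → T) : QAtom C R V Ind → Fact C R T
  | .unary B t => .unary B (t.evalT ι σ)
  | .role S s t => .role S (s.evalT ι σ) (t.evalT ι σ)

/-- terms(q). -/
def CQ.terms (q : CQ C R V Ind) : List (QTerm V Ind) :=
  q.atoms.flatMap fun a => match a with
    | .unary _ t => [t]
    | .role _ s t => [s, t]

/-- Ξ(K) ⊨ σ(q): every atom of q is mapped by σ into the minimal Herbrand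
    model of Ξ(K). -/
def holdsX (K : KB C R Ind) (q : CQ C R V Ind) (σ : V → XTerm C R Ind) : Prop :=
  ∀ a ∈ q.atoms, XI K (a.applyA XTerm.ind σ)

/-- dat(K) ⊨ τ(q). -/
def holdsD (K : KB C R Ind) (q : CQ C R V Ind) (τ : V → DTerm C R Ind) : Prop :=
  ∀ a ∈ q.atoms, DM K (a.applyA DTerm.ind τ)

/-- aux(dat(K)): the individuals u of dat(K) such that dat(K) ⊨ u ≈ c for no
    named individual c. -/
def auxDat (K : KB C R Ind) (u : DTerm C R Ind) : Prop :=
  ∀ a : Ind, ¬ DM K (.eq u (.ind a))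

/-- Extension of τ to the query terms (over dat(K)-terms). -/
def evalD (τ : V → DTerm C R Ind) : QTerm V Ind → DTerm C R Ind :=
  QTerm.evalT DTerm.ind τ

/-- Extension of π* to the query terms (over Ξ(K)-terms). -/
def evalX (σ : V → XTerm C R Ind) : QTerm V Ind → XTerm C R Ind :=
  QTerm.evalT XTerm.ind σ

/-- The relation ∼ on terms(q) for q, τ and dat(K): the smallest reflexive,
    symmetric and transitive relation closed under the fork rule. -/
inductive Sim (K : KB C R Ind) (q : CQ C R V Ind) (τ : V → DTerm C R Ind) :
    QTerm V Ind → QTerm V Ind → Prop where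
  | refl {t} : t ∈ q.terms → Sim K q τ t t
  | symm {s t} : Sim K q τ s t → Sim K q τ t s
  | trans {s t u} : Sim K q τ s t → Sim K q τ t u → Sim K q τ s u
  | fork {s s' t t' Rr P} : Sim K q τ s' t' → QAtom.role Rr s s' ∈ q.atoms →
      QAtom.role P t t' ∈ q.atoms → auxDat K (evalD τ s') → Sim K q τ s t

/-- The ∼-class of `t` is a vertex of G_aux, i.e. it contains a term mapped by
    τ to a 'true' auxiliary individual. -/
def isAuxVertex (K : KB C R Ind) (q : CQ C R V Ind) (τ : V → DTerm C R Ind)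
    (t : QTerm V Ind) : Prop :=
  ∃ t' ∈ q.terms, Sim K q τ t t' ∧ auxDat K (evalD τ t')

/-- The edge relation of G_aux, expressed on representatives modulo ∼:
    an edge from the class of u to the class of v for each atom R(s,t) of q
    with u ∼ s, v ∼ t and both classes vertices of G_aux. -/
def auxEdge (K : KB C R Ind) (q : CQ C R V Ind) (τ : V → DTerm C R Ind)
    (u v : QTerm V Ind) : Prop :=
  ∃ (S : R) (s t : QTerm V Ind), QAtom.role S s t ∈ q.atoms ∧
    Sim K q τ u s ∧ Sim K q τ v t ∧ isAuxVertex K q τ s ∧ isAuxVertex K q τ t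

/-- q is aux-cyclic w.r.t. τ and dat(K): G_aux contains a cycle. -/
def auxCyclic (K : KB C R Ind) (q : CQ C R V Ind) (τ : V → DTerm C R Ind) : Prop :=
  ∃ t, Relation.TransGen (auxEdge K q τ) t t

/-- isSpurious(q, dat(K), τ) = true. -/
def Spurious (K : KB C R Ind) (q : CQ C R V Ind) (τ : V → DTerm C R Ind) : Prop :=
  (∃ v, q.answers v ∧ ∀ a : Ind, τ v ≠ .ind a) ∨
  (∃ s t, Sim K q τ s t ∧ ¬ DM K (.eq (evalD τ s) (evalD τ t))) ∨
  auxCyclic K q τ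

open Classical in
/-- depth(w, I): 0 for terms outside aux(I), and 1 + depth of the argument for
    functional terms in aux(I). -/
noncomputable def depth (K : KB C R Ind) : XTerm C R Ind → ℕ
  | .ind _ => 0
  | .fn S A w => if auxT (XI K) XTerm.ind (.fn S A w) then 1 + depth K w else 0


/-- A term of Ξ(K) that is ≈-equal to a named individual. -/
def EqNamed (K : KB C R Ind) (w : XTerm C R Ind) : Prop := ∃ a : Ind, XI K (.eq w (.ind a))

/-- The image under δ of a fact of Ξ(K) holds in dat(K). An ≈-fact may also collapse to an
    identity, since congruence relates functional terms that occur in no other fact. -/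
def HoldsUnderδ (K : KB C R Ind) : Fact C R (XTerm C R Ind) → Prop
  | .unary B w => DM K (.unary B (δ w))
  | .role S w w' => DM K (.role S (δ w) (δ w'))
  | .eq w w' => DM K (.eq (δ w) (δ w')) ∨ δ w = δ w'

theorem XI.holdsUnderδ {K : KB C R Ind} {f : Fact C R (XTerm C R Ind)} (h : XI K f) :
    HoldsUnderδ K f := by
  induction h with
  | abU h => exact .abU h
  | abR h => exact .abR h
  | nom h => exact .nom h
  | sub h _ ih => exact .sub h ih
  | subNom h _ ih => exact Or.inl (.subNom h ih)
  | conj h _ _ ih₁ ih₂ => exact .conj h ih₁ ih₂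
  | exSub h _ _ ih₁ ih₂ => exact .exSub h ih₁ ih₂
  | subEx1 h _ ih => exact .subEx1 h ih
  | subEx2 h _ ih => exact .subEx2 h ih
  | roleSub h _ ih => exact .roleSub h ih
  | range h _ ih => exact .range h ih
  | topU h _ ih => exact .topU h ih
  | topR1 h _ ih => exact .topR1 h ih
  | topR2 h _ ih => exact .topR2 h ih
  | refl => exact Or.inr rfl
  | symm _ ih => exact ih.imp .symm Eq.symm
  | trans _ _ ih₁ ih₂ =>
    rcases ih₁ with h₁ | h₁
    · rcases ih₂ with h₂ | h₂
      · exact Or.inl (.trans h₁ h₂)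
      · exact Or.inl (h₂ ▸ h₁)
    · simpa only [HoldsUnderδ, h₁] using ih₂
  | repU _ _ ih₁ ih₂ =>
    rcases ih₂ with h | h
    · exact .repU ih₁ h
    · simpa only [HoldsUnderδ, h] using ih₁
  | repR1 _ _ ih₁ ih₂ =>
    rcases ih₂ with h | h
    · exact .repR1 ih₁ h
    · simpa only [HoldsUnderδ, h] using ih₁
  | repR2 _ _ ih₁ ih₂ =>
    rcases ih₂ with h | h
    · exact .repR2 ih₁ h
    · simpa only [HoldsUnderδ, h] using ih₁
  | repF => exact Or.inr rfl

theorem EqNamed.of_eq {K : KB C R Ind} {v w : XTerm C R Ind} (h : XI K (.eq v w)) :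
    EqNamed K w → EqNamed K v :=
  fun ⟨a, ha⟩ => ⟨a, .trans h ha⟩

/-- Equal terms are ≈-equal to a named individual, identical, or related by congruence. -/
theorem XI.eq_cases {K : KB C R Ind} {v v' : XTerm C R Ind} (h : XI K (.eq v v')) :
    EqNamed K v ∨ v = v' ∨
      ∃ S A w w', v = .fn S A w ∧ v' = .fn S A w' ∧ XI K (.eq w w') := by
  generalize hf : Fact.eq v v' = f at h
  induction h generalizing v v' <;> cases hf
  case subNom h hw _ => exact Or.inl ⟨_, .subNom h hw⟩
  case refl => exact Or.inr (Or.inl rfl)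
  case symm h ih =>
    rcases ih rfl with hn | rfl | ⟨S, A, w, w', rfl, rfl, hw⟩
    · exact Or.inl (hn.of_eq h.symm)
    · exact Or.inr (Or.inl rfl)
    · exact Or.inr (Or.inr ⟨S, A, w', w, rfl, rfl, hw.symm⟩)
  case trans h₁ h₂ ih₁ ih₂ =>
    rcases ih₁ rfl with hn | rfl | ⟨S, A, w, w', rfl, rfl, hw⟩
    · exact Or.inl hn
    · exact ih₂ rfl
    · rcases ih₂ rfl with hn | rfl | ⟨S', A', u, u', he, rfl, hu⟩
      · exact Or.inl (hn.of_eq h₁)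
      · exact Or.inr (Or.inr ⟨S, A, w, w', rfl, rfl, hw⟩)
      · cases he
        exact Or.inr (Or.inr ⟨S, A, w, u', rfl, rfl, hw.trans hu⟩)
  case repF S A w w' h _ => exact Or.inr (Or.inr ⟨S, A, w, w', rfl, rfl, h⟩)

/-- A role successor that is not ≈-equal to a named individual is a functional term over its
    predecessor, up to ≈. -/
theorem XI.role_cases {K : KB C R Ind} {P : R} {u v : XTerm C R Ind} (h : XI K (.role P u v)) :
    EqNamed K v ∨ ∃ S A w, v = .fn S A w ∧ XI K (.eq w u) := by
  generalize hf : Fact.role P u v = f at h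
  induction h generalizing P u v <;> cases hf
  case abR h => exact Or.inl ⟨_, .refl (.abR h) (Or.inr rfl)⟩
  case subEx1 hu _ => exact Or.inr ⟨_, _, _, rfl, .refl hu rfl⟩
  case roleSub ih => exact ih rfl
  case repR1 h ih _ =>
    exact (ih rfl).imp_right fun ⟨S, A, w, hv, hw⟩ => ⟨S, A, w, hv, hw.trans h⟩
  case repR2 h ih _ =>
    rcases ih rfl with hn | ⟨S, A, w, rfl, hw⟩
    · exact Or.inl (hn.of_eq h.symm)
    · rcases h.eq_cases with hn | rfl | ⟨S', A', w₁, w₂, he, rfl, hw'⟩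
      · exact Or.inl (hn.of_eq h.symm)
      · exact Or.inr ⟨S, A, w, rfl, hw⟩
      · cases he
        exact Or.inr ⟨S, A, w₂, rfl, hw'.symm.trans hw⟩

open Classical in
/-- The number of function symbols above the outermost subterm ≈-equal to a named individual. -/
noncomputable def height (K : KB C R Ind) : XTerm C R Ind → ℕ
  | .ind _ => 0
  | .fn S A w => if EqNamed K (.fn S A w) then 0 else 1 + height K w

theorem height_eq_zero {K : KB C R Ind} {w : XTerm C R Ind} (h : EqNamed K w) :
    height K w = 0 := by
  cases w with
  | ind => rfl
  | fn => exact if_pos h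

theorem XI.height_eq {K : KB C R Ind} {v v' : XTerm C R Ind} (h : XI K (.eq v v')) :
    height K v = height K v' := by
  generalize hf : Fact.eq v v' = f at h
  induction h generalizing v v' <;> cases hf
  case subNom h hw _ => exact height_eq_zero ⟨_, .subNom h hw⟩
  case refl => rfl
  case symm ih => exact (ih rfl).symm
  case trans ih₁ ih₂ => exact (ih₁ rfl).trans (ih₂ rfl)
  case repF S A w w' h ih =>
    have hiff : EqNamed K (.fn S A w) ↔ EqNamed K (.fn S A w') :=
      ⟨.of_eq (.repF h.symm), .of_eq (.repF h)⟩
    classical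
    rw [height, height, ih rfl]
    exact if_congr hiff rfl rfl

/-- Fork property: ≈-equal role successors that are not ≈-equal to a named individual have
    ≈-equal predecessors. -/
theorem XI.eq_of_role_of_role {K : KB C R Ind} {P Q : R} {u u' v v' : XTerm C R Ind}
    (h : XI K (.role P u u')) (h' : XI K (.role Q v v')) (he : XI K (.eq u' v'))
    (hn : ¬ EqNamed K u') : XI K (.eq u v) := by
  obtain ⟨S, A, w, rfl, hw⟩ := h.role_cases.resolve_left hn
  obtain ⟨S', A', w', rfl, hw'⟩ := h'.role_cases.resolve_left fun hv => hn (hv.of_eq he)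
  rcases he.eq_cases.resolve_left hn with heq | ⟨_, _, x, y, hx, hy, hxy⟩
  · cases heq
    exact hw.symm.trans hw'
  · cases hx
    cases hy
    exact hw.symm.trans (hxy.trans hw')

theorem XI.height_lt_of_role {K : KB C R Ind} {P : R} {u v : XTerm C R Ind}
    (h : XI K (.role P u v)) (hn : ¬ EqNamed K v) : height K u < height K v := by
  obtain ⟨S, A, w, rfl, hw⟩ := h.role_cases.resolve_left hn
  rw [height, if_neg hn, hw.height_eq]
  omega

theorem evalD_eq {τ : V → DTerm C R Ind} {πs : V → XTerm C R Ind} (hτ : ∀ v, τ v = δ (πs v))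
    (t : QTerm V Ind) : evalD τ t = δ (evalX πs t) := by
  cases t with
  | var v => exact hτ v
  | const => rfl

theorem CQ.exists_atom_of_mem_terms {q : CQ C R V Ind} {t : QTerm V Ind} (ht : t ∈ q.terms) :
    (∃ B, QAtom.unary B t ∈ q.atoms) ∨
      ∃ S s s', QAtom.role S s s' ∈ q.atoms ∧ (s = t ∨ s' = t) := by
  obtain ⟨a, ha, hta⟩ := List.mem_flatMap.mp ht
  cases a with
  | unary B s =>
    obtain rfl := List.mem_singleton.mp hta
    exact Or.inl ⟨B, ha⟩
  | role S s s' =>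
    refine Or.inr ⟨S, s, s', ha, ?_⟩
    simpa [eq_comm] using hta

theorem holdsX.eq_refl {K : KB C R Ind} {q : CQ C R V Ind} {πs : V → XTerm C R Ind}
    (hmap : holdsX K q πs) {t : QTerm V Ind} (ht : t ∈ q.terms) :
    XI K (.eq (evalX πs t) (evalX πs t)) := by
  rcases q.exists_atom_of_mem_terms ht with ⟨B, h⟩ | ⟨S, s, s', h, rfl | rfl⟩
  · exact .refl (hmap _ h) rfl
  · exact .refl (hmap _ h) (Or.inl rfl)
  · exact .refl (hmap _ h) (Or.inr rfl)

theorem holdsD.eq_refl {K : KB C R Ind} {q : CQ C R V Ind} {τ : V → DTerm C R Ind}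
    (hmap : holdsD K q τ) {t : QTerm V Ind} (ht : t ∈ q.terms) :
    DM K (.eq (evalD τ t) (evalD τ t)) := by
  rcases q.exists_atom_of_mem_terms ht with ⟨B, h⟩ | ⟨S, s, s', h, rfl | rfl⟩
  · exact .refl (hmap _ h) rfl
  · exact .refl (hmap _ h) (Or.inl rfl)
  · exact .refl (hmap _ h) (Or.inr rfl)

theorem holdsX.holdsD {K : KB C R Ind} {q : CQ C R V Ind} {πs : V → XTerm C R Ind}
    {τ : V → DTerm C R Ind} (hmap : holdsX K q πs) (hτ : ∀ v, τ v = δ (πs v)) :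
    holdsD K q τ := by
  intro a ha
  have h := (hmap a ha).holdsUnderδ
  cases a with
  | unary B t =>
    change DM K (.unary B (evalD τ t))
    rw [evalD_eq hτ]
    exact h
  | role S s t =>
    change DM K (.role S (evalD τ s) (evalD τ t))
    rw [evalD_eq hτ, evalD_eq hτ]
    exact h

theorem QAtom.mem_terms_of_role {q : CQ C R V Ind} {S : R} {s t : QTerm V Ind}
    (h : QAtom.role S s t ∈ q.atoms) : s ∈ q.terms ∧ t ∈ q.terms :=
  ⟨List.mem_flatMap.mpr ⟨_, h, by simp⟩, List.mem_flatMap.mpr ⟨_, h, by simp⟩⟩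

theorem Sim.mem_terms {K : KB C R Ind} {q : CQ C R V Ind} {τ : V → DTerm C R Ind}
    {s t : QTerm V Ind} (h : Sim K q τ s t) : s ∈ q.terms ∧ t ∈ q.terms := by
  induction h with
  | refl h => exact ⟨h, h⟩
  | symm _ ih => exact ih.symm
  | trans _ _ ih₁ ih₂ => exact ⟨ih₁.1, ih₂.2⟩
  | fork _ h₁ h₂ _ _ => exact ⟨(QAtom.mem_terms_of_role h₁).1, (QAtom.mem_terms_of_role h₂).1⟩

theorem not_eqNamed_of_auxDat {K : KB C R Ind} {q : CQ C R V Ind} {πs : V → XTerm C R Ind}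
    {τ : V → DTerm C R Ind} (hmap : holdsX K q πs) (hτ : ∀ v, τ v = δ (πs v))
    {t : QTerm V Ind} (ht : t ∈ q.terms) (haux : auxDat K (evalD τ t)) :
    ¬ EqNamed K (evalX πs t) := by
  rintro ⟨a, ha⟩
  have hrefl := (hmap.holdsD hτ).eq_refl ht
  apply haux a
  rw [evalD_eq hτ] at hrefl ⊢
  rcases ha.holdsUnderδ with h | h
  · exact h
  · rw [h] at hrefl ⊢
    exact hrefl

theorem Sim.eq_evalX {K : KB C R Ind} {q : CQ C R V Ind} {πs : V → XTerm C R Ind}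
    {τ : V → DTerm C R Ind} (hmap : holdsX K q πs) (hτ : ∀ v, τ v = δ (πs v))
    {s t : QTerm V Ind} (h : Sim K q τ s t) : XI K (.eq (evalX πs s) (evalX πs t)) := by
  induction h with
  | refl h => exact hmap.eq_refl h
  | symm _ ih => exact ih.symm
  | trans _ _ ih₁ ih₂ => exact ih₁.trans ih₂
  | fork h h₁ h₂ haux ih =>
    exact XI.eq_of_role_of_role (hmap _ h₁) (hmap _ h₂) ih
      (not_eqNamed_of_auxDat hmap hτ h.mem_terms.1 haux)

theorem Sim.eq_evalD {K : KB C R Ind} {q : CQ C R V Ind} {πs : V → XTerm C R Ind}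
    {τ : V → DTerm C R Ind} (hmap : holdsX K q πs) (hτ : ∀ v, τ v = δ (πs v))
    {s t : QTerm V Ind} (h : Sim K q τ s t) : DM K (.eq (evalD τ s) (evalD τ t)) := by
  have hrefl := (hmap.holdsD hτ).eq_refl h.mem_terms.1
  rw [evalD_eq hτ] at hrefl
  rw [evalD_eq hτ, evalD_eq hτ]
  rcases (h.eq_evalX hmap hτ).holdsUnderδ with h | h
  · exact h
  · rwa [← h]

theorem height_lt_of_auxEdge {K : KB C R Ind} {q : CQ C R V Ind} {πs : V → XTerm C R Ind}
    {τ : V → DTerm C R Ind} (hmap : holdsX K q πs) (hτ : ∀ v, τ v = δ (πs v))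
    {u v : QTerm V Ind} (h : auxEdge K q τ u v) :
    height K (evalX πs u) < height K (evalX πs v) := by
  obtain ⟨S, s, t, hst, hus, hvt, -, t', ht', htt', haux⟩ := h
  rw [(hus.eq_evalX hmap hτ).height_eq, (hvt.eq_evalX hmap hτ).height_eq]
  exact XI.height_lt_of_role (hmap _ hst) fun hn =>
    not_eqNamed_of_auxDat hmap hτ ht' haux (hn.of_eq (htt'.eq_evalX hmap hτ).symm)

theorem not_auxCyclic {K : KB C R Ind} {q : CQ C R V Ind} {πs : V → XTerm C R Ind}
    {τ : V → DTerm C R Ind} (hmap : holdsX K q πs) (hτ : ∀ v, τ v = δ (πs v)) :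
    ¬ auxCyclic K q τ := by
  rintro ⟨t, ht⟩
  have hlt : ∀ {v}, Relation.TransGen (auxEdge K q τ) t v →
      height K (evalX πs t) < height K (evalX πs v) := by
    intro v h
    induction h with
    | single h => exact height_lt_of_auxEdge hmap hτ h
    | tail _ h ih => exact ih.trans (height_lt_of_auxEdge hmap hτ h)
  exact lt_irrefl _ (hlt ht)

/-- Completeness: if Ξ(K) ⊨ π(q), witnessed by π*, then τ = δ ∘ π* extends π,
    satisfies dat(K) ⊨ τ(q), and is not spurious. -/
theorem completeness (K : KB C R Ind)
    (hsat : ¬ ∃ w : XTerm C R Ind, XI K (.unary .bot w))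
    (q : CQ C R V Ind) (π : V → Ind) (πs : V → XTerm C R Ind)
    (hans : ∀ v, q.answers v → πs v = .ind (π v))
    (hmap : holdsX K q πs)
    (τ : V → DTerm C R Ind) (hτ : ∀ v, τ v = δ (πs v)) :
    (∀ v, q.answers v → τ v = .ind (π v)) ∧ holdsD K q τ ∧
    ¬ Spurious K q τ := by
  have hext : ∀ v, q.answers v → τ v = .ind (π v) := fun v hv => by
    rw [hτ, hans v hv]
    rfl
  refine ⟨hext, hmap.holdsD hτ, ?_⟩
  rintro (⟨v, hv, hne⟩ | ⟨s, t, hst, hne⟩ | hcyc)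
  · exact hne _ (hext v hv)
  · exact hne (hst.eq_evalD hmap hτ)
  · exact not_auxCyclic hmap hτ hcyc

end ELHO
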